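/- arXiv:2403.17274 — 3 statements merged into one kernel-verified Lean document; each statement's English description precedes it below -/
import Mathlib

section
/- Let Φ be an irreducible crystallographic root system. Every negatively coclosed subset Σ ⊆ Φ⁺ is Worpitzky-compatible; in particular, every coclosed subset is Worpitzky-compatible. -/
open scoped InnerProductSpace

noncomputable section

/-- Ambient Euclidean space `ℝ^ℓ` with the standard inner product. -/
abbrev EucV (ℓ : ℕ) : Type := EuclideanSpace ℝ (Fin ℓ)

variable {ℓ : ℕ}

/-- `α` is a nonnegative integer combination of elements of `D`. -/
def IsNNIntComb (D : Set (EucV ℓ)) (α : EucV ℓ) : Prop :=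
  ∃ (s : Finset (EucV ℓ)) (c : EucV ℓ → ℕ), (↑s : Set (EucV ℓ)) ⊆ D ∧
    α = ∑ b ∈ s, (c b : ℝ) • b

/-- Data of a reduced crystallographic root system `Φ` spanning `ℝ^ℓ`, together with a
fixed simple system `Δ` (every root is a nonnegative or nonpositive integer
combination of `Δ`). -/
structure RootSystemData (ℓ : ℕ) where
  Φ : Set (EucV ℓ)
  Δ : Set (EucV ℓ)
  finite : Φ.Finite
  nonzero : (0 : EucV ℓ) ∉ Φ
  spanning : Submodule.span ℝ Φ = ⊤
  neg_mem : ∀ α ∈ Φ, -α ∈ Φ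
  reduced : ∀ α ∈ Φ, ∀ t : ℝ, t • α ∈ Φ → t = 1 ∨ t = -1
  cryst : ∀ α ∈ Φ, ∀ β ∈ Φ, ∃ n : ℤ, 2 * ⟪β, α⟫_ℝ = (n : ℝ) * ⟪α, α⟫_ℝ
  refl_mem : ∀ α ∈ Φ, ∀ β ∈ Φ, β - (2 * ⟪β, α⟫_ℝ / ⟪α, α⟫_ℝ) • α ∈ Φ
  simple_sub : Δ ⊆ Φ
  simple_indep : LinearIndependent ℝ (fun a : Δ => (a : EucV ℓ))
  pos_or_neg : ∀ α ∈ Φ, IsNNIntComb Δ α ∨ IsNNIntComb Δ (-α)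

/-- A set of vectors is irreducible if it admits no decomposition into two nonempty
mutually orthogonal parts. -/
def IrredSet (S : Set (EucV ℓ)) : Prop :=
  ¬ ∃ S₁ S₂ : Set (EucV ℓ), S₁.Nonempty ∧ S₂.Nonempty ∧ S = S₁ ∪ S₂ ∧
      ∀ a ∈ S₁, ∀ b ∈ S₂, ⟪a, b⟫_ℝ = 0

namespace RootSystemData

variable (rs : RootSystemData ℓ)

/-- The positive system `Φ⁺` determined by the simple system `Δ`. -/
def Pos : Set (EucV ℓ) := {α ∈ rs.Φ | IsNNIntComb rs.Δ α}

/-- `X` is a codimension-two intersection of reflecting hyperplanes of `Φ`. -/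
def IsCodim2Flat (X : Set (EucV ℓ)) : Prop :=
  ∃ α ∈ rs.Pos, ∃ β ∈ rs.Pos, (¬ ∃ t : ℝ, β = t • α) ∧
    X = {x : EucV ℓ | ⟪α, x⟫_ℝ = 0 ∧ ⟪β, x⟫_ℝ = 0}

/-- The localization `Φ_X = Φ ∩ X^⊥`. -/
def locΦ (X : Set (EucV ℓ)) : Set (EucV ℓ) := {γ ∈ rs.Φ | ∀ x ∈ X, ⟪γ, x⟫_ℝ = 0}

/-- The positive system `Φ⁺_X = Φ⁺ ∩ Φ_X` of the localization. -/
def locPos (X : Set (EucV ℓ)) : Set (EucV ℓ) := rs.Pos ∩ rs.locΦ X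

/-- The (two-dimensional) linear span of the localization `Φ_X`, as a set. -/
def locSpan (X : Set (EucV ℓ)) : Set (EucV ℓ) :=
  (Submodule.span ℝ (rs.locΦ X) : Set (EucV ℓ))

end RootSystemData

/-- The indecomposable elements of a positive system `P`; for a positive system of a
root (sub)system this is the associated simple system. -/
def simplesOf (P : Set (EucV ℓ)) : Set (EucV ℓ) :=
  {α ∈ P | ¬ ∃ β ∈ P, ∃ γ ∈ P, α = β + γ}

/-- The simple system `Δ_X` of the localization `Φ_X` associated to `Φ⁺_X`. -/
def RootSystemData.locΔ (rs : RootSystemData ℓ) (X : Set (EucV ℓ)) : Set (EucV ℓ) :=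
  simplesOf (rs.locPos X)

/-- The union of the affine hyperplanes `H_α^n` (`α ∈ P`, `n ∈ ℤ`), traced on the
carrier set `U`. -/
def hypUnion (U P : Set (EucV ℓ)) : Set (EucV ℓ) :=
  {x ∈ U | ∃ α ∈ P, ∃ n : ℤ, ⟪α, x⟫_ℝ = (n : ℝ)}

/-- `A` is an alcove: a connected component of the complement (in the carrier `U`)
of all the affine hyperplanes `H_α^n`, `α ∈ P`, `n ∈ ℤ`. -/
def IsAlcove (U P A : Set (EucV ℓ)) : Prop :=
  ∃ x ∈ U \ hypUnion U P, A = connectedComponentIn (U \ hypUnion U P) x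

/-- `r` is the address of the alcove `A`: for each `γ ∈ P` and `x ∈ A` one has
`r γ - 1 < ⟪γ, x⟫ < r γ`. -/
def IsAddress (P A : Set (EucV ℓ)) (r : EucV ℓ → ℤ) : Prop :=
  ∀ γ ∈ P, ∀ x ∈ A, ((r γ : ℝ) - 1 < ⟪γ, x⟫_ℝ ∧ ⟪γ, x⟫_ℝ < (r γ : ℝ))

/-- The upper closure `A^◊` of an alcove `A` with address `r`. -/
def upperClos (P A : Set (EucV ℓ)) (r : EucV ℓ → ℤ) : Set (EucV ℓ) :=
  {x ∈ closure A | ∀ γ ∈ P, (r γ : ℝ) - 1 < ⟪γ, x⟫_ℝ}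

/-- The hyperplane `H_β^m` (traced on the carrier `U`) is a wall of the alcove `A`,
i.e. it supports a facet of `closure A`: its intersection with `closure A` affinely
spans the whole trace of the hyperplane on `U`. -/
def IsWall (U : Set (EucV ℓ)) (β : EucV ℓ) (m : ℤ) (A : Set (EucV ℓ)) : Prop :=
  ∀ y ∈ U, ⟪β, y⟫_ℝ = (m : ℝ) →
    y ∈ affineSpan ℝ ({x ∈ U | ⟪β, x⟫_ℝ = (m : ℝ)} ∩ closure A)

/-- The fundamental parallelepiped `P^◊` determined by the simple system `D`,
traced on the carrier `U`. -/
def fundPar (U D : Set (EucV ℓ)) : Set (EucV ℓ) :=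
  {x ∈ U | ∀ a ∈ D, 0 < ⟪a, x⟫_ℝ ∧ ⟪a, x⟫_ℝ ≤ 1}

/-- Worpitzky-compatibility of `S` (inside carrier `U`, with positive system `P` and
simple system `D`): for every alcove `A ⊆ P^◊`, every `α ∈ S` and every `n ∈ ℤ`, the
intersection `A^◊ ∩ H_α^n` is empty or contained in a ceiling `H_β^m` of `A`
(a wall with `m = r(A,β) ≥ 1`) with `β ∈ S`. -/
def WCompat (U P D S : Set (EucV ℓ)) : Prop :=
  ∀ A : Set (EucV ℓ), IsAlcove U P A → A ⊆ fundPar U D →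
    ∀ r : EucV ℓ → ℤ, IsAddress P A r →
      ∀ α ∈ S, ∀ n : ℤ,
        upperClos P A r ∩ {x : EucV ℓ | ⟪α, x⟫_ℝ = (n : ℝ)} = ∅ ∨
        ∃ β ∈ S, ∃ m : ℤ, m = r β ∧ 1 ≤ m ∧ IsWall U β m A ∧
          upperClos P A r ∩ {x : EucV ℓ | ⟪α, x⟫_ℝ = (n : ℝ)} ⊆
            {x : EucV ℓ | ⟪β, x⟫_ℝ = (m : ℝ)}

/-- `S` is 2-locally (Worpitzky-)compatible: for every codimension-two flat `X` with
`Φ_X` irreducible, the localization `S ∩ Φ⁺_X` is Worpitzky-compatible in `Φ_X`,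
inside the two-dimensional span of `Φ_X`, with respect to `Δ_X`. -/
def TwoLocallyCompat (rs : RootSystemData ℓ) (S : Set (EucV ℓ)) : Prop :=
  ∀ X : Set (EucV ℓ), rs.IsCodim2Flat X → IrredSet (rs.locΦ X) →
    WCompat (rs.locSpan X) (rs.locPos X) (rs.locΔ X) (S ∩ rs.locPos X)

/-- `S` is 2-locally simple: for every codimension-two flat `X` with `Φ_X`
irreducible, either `S ∩ Φ⁺_X` contains a simple root of `Φ_X` or it is empty. -/
def TwoLocallySimple (rs : RootSystemData ℓ) (S : Set (EucV ℓ)) : Prop :=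
  ∀ X : Set (EucV ℓ), rs.IsCodim2Flat X → IrredSet (rs.locΦ X) →
    ((S ∩ rs.locPos X) ∩ rs.locΔ X).Nonempty ∨ S ∩ rs.locPos X = ∅

/-- `S` is negatively coclosed in the positive system `P`. -/
def NegCoclosed (P S : Set (EucV ℓ)) : Prop :=
  ∀ α ∈ S, ∀ β₁ ∈ P, ∀ β₂ ∈ P, ∀ d₁ d₂ : ℤ, 0 < d₁ → 0 < d₂ →
    α = (d₁ : ℝ) • β₁ + (d₂ : ℝ) • β₂ → ⟪β₁, β₂⟫_ℝ < 0 → β₁ ∈ S ∨ β₂ ∈ S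

/-- `S` is coclosed in the positive system `P`. -/
def Coclosed (P S : Set (EucV ℓ)) : Prop :=
  ∀ α ∈ S, ∀ β₁ ∈ P, ∀ β₂ ∈ P, ∀ d₁ d₂ : ℤ, 0 < d₁ → 0 < d₂ →
    α = (d₁ : ℝ) • β₁ + (d₂ : ℝ) • β₂ → β₁ ∈ S ∨ β₂ ∈ S

/-- The root order: `β ≤ γ` iff `γ - β` is a nonnegative integer combination of the
simple roots in `D`. -/
def rootLE (D : Set (EucV ℓ)) (β γ : EucV ℓ) : Prop := IsNNIntComb D (γ - β)

/-- The defining recursion (on `Φ⁺`) for the function `r` of Lemma 3.8, with respect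
to `Δ_X = {γ₁, γ₂}`:
(i) `r β = 1` if `β ∈ Δ` or `β ≤ γ₁` or `β ≤ γ₂`;
(ii) if `β ∉ Δ`, `β ≰ γ₁`, `β ≰ γ₂` and `β - γᵢ ∈ Φ⁺` for `i = 1` or `2`, then
`r β = r (β - γᵢ) + 1`;
(iii) otherwise `r β = max { r (β - α) : α ∈ Δ, β - α ∈ Φ⁺ }`. -/
def AddrSpec (rs : RootSystemData ℓ) (γ₁ γ₂ : EucV ℓ) (r : EucV ℓ → ℤ) : Prop :=
  (∀ β ∈ rs.Pos, (β ∈ rs.Δ ∨ rootLE rs.Δ β γ₁ ∨ rootLE rs.Δ β γ₂) → r β = 1) ∧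
  (∀ β ∈ rs.Pos, β ∉ rs.Δ → ¬ rootLE rs.Δ β γ₁ → ¬ rootLE rs.Δ β γ₂ →
    ((β - γ₁ ∈ rs.Pos → r β = r (β - γ₁) + 1) ∧
     (β - γ₂ ∈ rs.Pos → r β = r (β - γ₂) + 1))) ∧
  (∀ β ∈ rs.Pos, β ∉ rs.Δ → ¬ rootLE rs.Δ β γ₁ → ¬ rootLE rs.Δ β γ₂ →
    β - γ₁ ∉ rs.Pos → β - γ₂ ∉ rs.Pos →
    ∃ α ∈ rs.Δ, β - α ∈ rs.Pos ∧ r β = r (β - α) ∧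
      ∀ α' ∈ rs.Δ, β - α' ∈ rs.Pos → r (β - α') ≤ r (β - α))

section Core

variable {E : Type*} [NormedAddCommGroup E] [InnerProductSpace ℝ E]

/-- Cartan integers of two non proportional roots at an acute angle. -/
theorem wc_cartan (a b : E) (ha : a ≠ 0) (hb : b ≠ 0) (hab : 0 < ⟪a, b⟫_ℝ)
    (hpar : ∀ t : ℝ, b ≠ t • a) (m k : ℤ) (hm : 2 * ⟪a, b⟫_ℝ = m * ⟪a, a⟫_ℝ)
    (hk : 2 * ⟪a, b⟫_ℝ = k * ⟪b, b⟫_ℝ) :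
    1 ≤ m ∧ 1 ≤ k ∧ (m = 1 ∨ k = 1) ∧ m ≤ 3 ∧ k ≤ 3 := by
  have haa : 0 < ⟪a, a⟫_ℝ := real_inner_self_pos.2 ha
  have hbb : 0 < ⟪b, b⟫_ℝ := real_inner_self_pos.2 hb
  have hm0 : (0:ℝ) < m := by
    by_contra h
    nlinarith
  have hk0 : (0:ℝ) < k := by
    by_contra h
    nlinarith
  have hcs : ⟪a, b⟫_ℝ * ⟪a, b⟫_ℝ < ⟪a, a⟫_ℝ * ⟪b, b⟫_ℝ := by
    have hne : b - (⟪a, b⟫_ℝ / ⟪a, a⟫_ℝ) • a ≠ 0 := fun h => hpar _ (sub_eq_zero.1 h)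
    have h1 := real_inner_self_pos.2 hne
    simp only [inner_sub_left, inner_sub_right, real_inner_smul_left, real_inner_smul_right,
      real_inner_comm a b] at h1
    have h2 : ⟪b, b⟫_ℝ - ⟪a, b⟫_ℝ / ⟪a, a⟫_ℝ * ⟪a, b⟫_ℝ > 0 := by
      have : ⟪a, b⟫_ℝ / ⟪a, a⟫_ℝ * ⟪a, a⟫_ℝ = ⟪a, b⟫_ℝ := by field_simp
      rw [this] at h1
      have h3 := real_inner_comm a b
      rw [← h3] at h1 ⊢
      linarith
    have h3 := mul_pos h2 haa
    have h4 : (⟪b, b⟫_ℝ - ⟪a, b⟫_ℝ / ⟪a, a⟫_ℝ * ⟪a, b⟫_ℝ) * ⟪a, a⟫_ℝ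
        = ⟪b, b⟫_ℝ * ⟪a, a⟫_ℝ - ⟪a, b⟫_ℝ * ⟪a, b⟫_ℝ := by field_simp
    linarith
  have hmk : (m:ℝ) * k < 4 := by
    by_contra h
    push Not at h
    have : 4 * (⟪a, b⟫_ℝ * ⟪a, b⟫_ℝ) = (m * k) * (⟪a, a⟫_ℝ * ⟪b, b⟫_ℝ) := by
      linear_combination 2 * ⟪a, b⟫_ℝ * hm + m * ⟪a, a⟫_ℝ * hk
    nlinarith [mul_pos haa hbb]
  have hm1 : 0 < m := by exact_mod_cast hm0
  have hk1 : 0 < k := by exact_mod_cast hk0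
  have hmk' : m * k < 4 := by exact_mod_cast hmk
  refine ⟨hm1, hk1, ?_, by nlinarith, by nlinarith⟩
  by_contra h
  push Not at h
  have : 2 ≤ m := by omega
  have : 2 ≤ k := by omega
  nlinarith

theorem wc_core (Ψ : Set E) (hfin : Ψ.Finite) (hneg : ∀ b ∈ Ψ, -b ∈ Ψ)
    (hred : ∀ a ∈ Ψ, ∀ t : ℝ, t • a ∈ Ψ → t = 1 ∨ t = -1)
    (hcry : ∀ a ∈ Ψ, ∀ b ∈ Ψ, ∃ n : ℤ, 2 * ⟪a, b⟫_ℝ = n * ⟪a, a⟫_ℝ ∧ b - (n : ℝ) • a ∈ Ψ)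
    (v : E) (hv : ∀ b ∈ Ψ, ⟪b, v⟫_ℝ ≠ 0)
    (a : E) (ha : a ∈ Ψ) (hav : 0 < ⟪a, v⟫_ℝ)
    (hgood : ∀ p ∈ Ψ, ∀ q ∈ Ψ, 0 < ⟪p, v⟫_ℝ → 0 < ⟪q, v⟫_ℝ → ∀ d₁ d₂ : ℤ, 0 < d₁ → 0 < d₂ →
      a = (d₁ : ℝ) • p + (d₂ : ℝ) • q → ¬ ⟪p, q⟫_ℝ < 0)
    (b : E) (hb : b ∈ Ψ) (hbv : 0 < ⟪b, v⟫_ℝ) (hba : b ≠ a) :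
    ⟪a, v⟫_ℝ * ⟪a, b⟫_ℝ < ⟪b, v⟫_ℝ * ⟪a, a⟫_ℝ := by
  have hne : ∀ c ∈ Ψ, c ≠ 0 := fun c hc h => hv c hc (by simp [h])
  have haa : 0 < ⟪a, a⟫_ℝ := real_inner_self_pos.2 (hne a ha)
  -- two Cartan integers
  have hC : ∀ c ∈ Ψ, 0 < ⟪c, v⟫_ℝ → c ≠ a → 0 < ⟪a, c⟫_ℝ → ∃ m k : ℤ,
      2 * ⟪a, c⟫_ℝ = m * ⟪a, a⟫_ℝ ∧ 2 * ⟪a, c⟫_ℝ = k * ⟪c, c⟫_ℝ ∧ c - (m:ℝ) • a ∈ Ψ ∧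
      a - (k:ℝ) • c ∈ Ψ ∧ 1 ≤ m ∧ 1 ≤ k ∧ (m = 1 ∨ k = 1) ∧ m ≤ 3 ∧ k ≤ 3 := by
    intro c hc hcv hca hac
    obtain ⟨m, hm, hm'⟩ := hcry a ha c hc
    obtain ⟨k, hk, hk'⟩ := hcry c hc a ha
    rw [real_inner_comm] at hk
    refine ⟨m, k, hm, hk, hm', hk', wc_cartan a c (hne a ha) (hne c hc) hac ?_ m k hm hk⟩
    rintro t rfl
    rcases hred a ha t hc with h | h
    · exact hca (by simp [h])
    · subst h
      simp only [neg_smul, one_smul, inner_neg_left] at hcv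
      linarith
  by_contra hcon
  push Not at hcon
  have hab : 0 < ⟪a, b⟫_ℝ := by
    by_contra h
    push Not at h
    nlinarith [mul_pos hbv haa]
  -- Step 1
  have hD : ∃ c ∈ Ψ, 0 < ⟪c, v⟫_ℝ ∧ 0 < ⟪a, c⟫_ℝ ∧ ⟪c, v⟫_ℝ < ⟪a, v⟫_ℝ := by
    obtain ⟨m, k, hm, hk, hm', hk', hm1, hk1, hmk, hm3, hk3⟩ := hC b hb hbv hba hab
    have hle : 2 * ⟪b, v⟫_ℝ ≤ m * ⟪a, v⟫_ℝ := by
      have : 2 * ⟪b, v⟫_ℝ * ⟪a, a⟫_ℝ ≤ m * ⟪a, v⟫_ℝ * ⟪a, a⟫_ℝ := by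
        calc 2 * ⟪b, v⟫_ℝ * ⟪a, a⟫_ℝ ≤ ⟪a, v⟫_ℝ * (2 * ⟪a, b⟫_ℝ) := by linarith
          _ = _ := by rw [hm]; ring
      exact le_of_mul_le_mul_right this haa
    by_cases hlt : ⟪b, v⟫_ℝ < ⟪a, v⟫_ℝ
    · exact ⟨b, hb, hbv, hab, hlt⟩
    push Not at hlt
    have hm2 : m = 2 ∨ m = 3 := by
      rcases (by omega : m = 1 ∨ m = 2 ∨ m = 3) with h | h
      · subst h; push_cast at hle; linarith
      · exact h
    have hk : k = 1 := by omega
    subst hk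
    have hab1 : a - b ∈ Ψ := by simpa using hk'
    have hab0 := hv _ hab1
    rw [inner_sub_left] at hab0
    have hlt' : ⟪a, v⟫_ℝ < ⟪b, v⟫_ℝ := lt_of_le_of_ne hlt (fun h => hab0 (by linarith))
    rcases hm2 with h | h
    · subst h; push_cast at hle; linarith
    · subst h
      push_cast at hle hm
      refine ⟨b - a, by simpa using hneg _ hab1, ?_, ?_, ?_⟩
      · rw [inner_sub_left]; linarith
      · rw [inner_sub_right]; linarith
      · rw [inner_sub_left]; linarith
  -- Step 2
  set D := {c ∈ Ψ | 0 < ⟪c, v⟫_ℝ ∧ 0 < ⟪a, c⟫_ℝ ∧ ⟪c, v⟫_ℝ < ⟪a, v⟫_ℝ} with hDdef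
  have hDfin : D.Finite := hfin.subset (fun c hc => hc.1)
  have hDne : D.Nonempty := by
    obtain ⟨c, h1, h2⟩ := hD
    exact ⟨c, h1, h2⟩
  obtain ⟨c, ⟨hc, hcv, hac, hca⟩, hmin⟩ :=
    Set.exists_min_image D (fun c => ⟪c, v⟫_ℝ) hDfin hDne
  have hcne : c ≠ a := by rintro rfl; exact lt_irrefl _ hca
  obtain ⟨m, k, hm, hk, hm', hk', hm1, hk1, hmk, hm3, hk3⟩ := hC c hc hcv hcne hac
  have hneg' : ⟪a - (k:ℝ) • c, v⟫_ℝ < 0 := by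
    rcases lt_or_gt_of_ne (hv _ hk') with h | h
    · exact h
    · exfalso
      refine hgood _ hk' c hc h hcv 1 k one_pos (by omega) (by simp) ?_
      rw [inner_sub_left, real_inner_smul_left]
      linarith
  rw [inner_sub_left, real_inner_smul_left] at hneg'
  rcases (by omega : k = 1 ∨ k = 2 ∨ k = 3) with h | h | h
  · subst h; push_cast at hneg'; linarith
  all_goals
    have hm : m = 1 := by omega
    subst hm
    subst h
    push_cast at hneg' hk hm hm' hk'
    have hacP : a - c ∈ Ψ := by simpa using hneg _ hm'
    have hmn := hmin (a - c) ⟨hacP, by rw [inner_sub_left]; linarith,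
      by rw [inner_sub_right]; linarith, by rw [inner_sub_left]; linarith⟩
    simp only [inner_sub_left] at hmn
  · linarith
  · have h2 : a - (2:ℝ) • c ∈ Ψ := by
      obtain ⟨n, hn, hn'⟩ := hcry c hc _ hacP
      have hcc : 0 < ⟪c, c⟫_ℝ := real_inner_self_pos.2 (hne c hc)
      have : n = 1 := by
        rw [inner_sub_right, real_inner_comm] at hn
        have : (n:ℝ) = 1 := by
          have : ((n:ℝ) - 1) * ⟪c, c⟫_ℝ = 0 := by linarith
          rcases mul_eq_zero.1 this with h | h <;> linarith
        exact_mod_cast this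
      subst this
      convert hn' using 1
      push_cast
      module
    have h2v : 0 < ⟪a - (2:ℝ) • c, v⟫_ℝ := by
      refine lt_of_le_of_ne ?_ (hv _ h2).symm
      rw [inner_sub_left, real_inner_smul_left]; linarith
    have h3 := hneg _ hk'
    refine hgood _ h2 _ h3 h2v ?_ 3 2 (by norm_num) (by norm_num) ?_ ?_
    · rw [inner_neg_left, inner_sub_left, real_inner_smul_left]; linarith
    · push_cast; module
    · simp only [inner_neg_right, inner_sub_left, inner_sub_right, real_inner_smul_left,
        real_inner_smul_right, real_inner_comm a c]
      have := real_inner_comm a c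
      have hcc : 0 < ⟪c, c⟫_ℝ := real_inner_self_pos.2 (hne c hc)
      linarith

end Core

open Filter Topology in
theorem wc_segment_eventually {V : Type*} [NormedAddCommGroup V] [InnerProductSpace ℝ V]
    (P : Set V) (hP : P.Finite) (r : V → ℤ) (α x w : V)
    (hx : ∀ γ ∈ P, (r γ : ℝ) - 1 < ⟪γ, x⟫_ℝ ∧ ⟪γ, x⟫_ℝ ≤ r γ)
    (hw : ∀ γ ∈ P, γ ≠ α → ⟪γ, x⟫_ℝ = r γ → ⟪γ, w⟫_ℝ < 0) :
    ∃ ε : ℝ, 0 < ε ∧ ∀ γ ∈ P, (r γ : ℝ) - 1 < ⟪γ, x + ε • w⟫_ℝ ∧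
      (γ ≠ α → ⟪γ, x + ε • w⟫_ℝ < r γ) := by
  have key : ∀ᶠ ε : ℝ in 𝓝[>] 0, ∀ γ ∈ P, (r γ : ℝ) - 1 < ⟪γ, x + ε • w⟫_ℝ ∧
      (γ ≠ α → ⟪γ, x + ε • w⟫_ℝ < r γ) := by
    rw [Filter.eventually_all_finite hP]
    intro γ hγ
    have ht : Tendsto (fun ε : ℝ => ⟪γ, x + ε • w⟫_ℝ) (𝓝[>] 0) (𝓝 ⟪γ, x⟫_ℝ) := by
      have hc : Continuous (fun ε : ℝ => ⟪γ, x + ε • w⟫_ℝ) := by fun_prop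
      have := hc.tendsto 0
      simp only [zero_smul, add_zero] at this
      exact this.mono_left nhdsWithin_le_nhds
    have h1 := ht.eventually (lt_mem_nhds (hx γ hγ).1)
    rcases (hx γ hγ).2.lt_or_eq with hlt | heq
    · filter_upwards [h1, ht.eventually (gt_mem_nhds hlt)] with ε h1 h2
      exact ⟨h1, fun _ => h2⟩
    · filter_upwards [h1, self_mem_nhdsWithin] with ε h1 h2
      refine ⟨h1, fun hne => ?_⟩
      have := hw γ hγ hne heq
      rw [inner_add_right, real_inner_smul_right, heq]
      have h2 : (0:ℝ) < ε := h2
      nlinarith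
  obtain ⟨ε, h, h0⟩ := (key.and self_mem_nhdsWithin).exists
  exact ⟨ε, h0, h⟩

theorem wc_pos_finite (rs : RootSystemData ℓ) : rs.Pos.Finite :=
  rs.finite.subset (fun _ h => h.1)

theorem wc_alcove_mem (P A : Set (EucV ℓ)) (hA : IsAlcove Set.univ P A)
    (r : EucV ℓ → ℤ) (hr : IsAddress P A r) (z : EucV ℓ)
    (hz : ∀ γ ∈ P, (r γ : ℝ) - 1 < ⟪γ, z⟫_ℝ ∧ ⟪γ, z⟫_ℝ < r γ) : z ∈ A := by
  obtain ⟨x₀, hx₀, rfl⟩ := hA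
  set C : Set (EucV ℓ) := {z | ∀ γ ∈ P, (r γ : ℝ) - 1 < ⟪γ, z⟫_ℝ ∧ ⟪γ, z⟫_ℝ < r γ} with hC
  have hconv : Convex ℝ C := by
    intro y hy z hz s t hs ht hst γ hγ
    have h1 := hy γ hγ
    have h2 := hz γ hγ
    rw [inner_add_right, real_inner_smul_right, real_inner_smul_right]
    have ht' : t = 1 - s := by linarith
    subst ht'
    rcases hs.eq_or_lt with h | h
    · subst h; simpa using h2
    · constructor <;> nlinarith
  have hx₀A := mem_connectedComponentIn hx₀
  have hsub : C ⊆ Set.univ \ hypUnion Set.univ P := by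
    rintro y hy
    refine ⟨trivial, ?_⟩
    rintro ⟨-, γ, hγ, n, hn⟩
    have := hy γ hγ
    rw [hn] at this
    have h1 : r γ - 1 < n := by exact_mod_cast this.1
    have h2 : n < r γ := by exact_mod_cast this.2
    omega
  exact hconv.isPreconnected.subset_connectedComponentIn
    (fun γ hγ => hr γ hγ x₀ hx₀A) hsub hz

theorem wc_closure_le (P A : Set (EucV ℓ)) (r : EucV ℓ → ℤ) (hr : IsAddress P A r)
    (z : EucV ℓ) (hz : z ∈ closure A) (γ : EucV ℓ) (hγ : γ ∈ P) :
    (r γ : ℝ) - 1 ≤ ⟪γ, z⟫_ℝ ∧ ⟪γ, z⟫_ℝ ≤ r γ := by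
  have hc : Continuous (fun z : EucV ℓ => ⟪γ, z⟫_ℝ) := by fun_prop
  have : IsClosed {z : EucV ℓ | (r γ : ℝ) - 1 ≤ ⟪γ, z⟫_ℝ ∧ ⟪γ, z⟫_ℝ ≤ r γ} :=
    (isClosed_le continuous_const hc).inter (isClosed_le hc continuous_const)
  have hsub : A ⊆ {z : EucV ℓ | (r γ : ℝ) - 1 ≤ ⟪γ, z⟫_ℝ ∧ ⟪γ, z⟫_ℝ ≤ r γ} :=
    fun y hy => ⟨(hr γ hγ y hy).1.le, (hr γ hγ y hy).2.le⟩
  exact closure_minimal hsub this hz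

open Filter Topology in
theorem wc_mem_closure (P A : Set (EucV ℓ)) (hA : IsAlcove Set.univ P A)
    (r : EucV ℓ → ℤ) (hr : IsAddress P A r) (z : EucV ℓ)
    (hz : ∀ γ ∈ P, (r γ : ℝ) - 1 ≤ ⟪γ, z⟫_ℝ ∧ ⟪γ, z⟫_ℝ ≤ r γ) : z ∈ closure A := by
  obtain ⟨x₀, hx₀⟩ : A.Nonempty := by
    obtain ⟨x₀, hx₀, rfl⟩ := hA
    exact ⟨x₀, mem_connectedComponentIn hx₀⟩
  have ht : Tendsto (fun ε : ℝ => z + ε • (x₀ - z)) (𝓝[>] 0) (𝓝 z) := by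
    have hc : Continuous (fun ε : ℝ => z + ε • (x₀ - z)) := by fun_prop
    have := hc.tendsto 0
    simp only [zero_smul, add_zero] at this
    exact this.mono_left nhdsWithin_le_nhds
  refine mem_closure_of_tendsto ht ?_
  filter_upwards [self_mem_nhdsWithin,
    mem_nhdsWithin_of_mem_nhds (gt_mem_nhds (zero_lt_one' ℝ))] with ε h0 h1
  have h0 : (0:ℝ) < ε := h0
  have h1 : ε < 1 := h1
  refine wc_alcove_mem P A hA r hr _ (fun γ hγ => ?_)
  have a1 := hr γ hγ x₀ hx₀
  have a2 := hz γ hγ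
  rw [inner_add_right, real_inner_smul_right, inner_sub_right]
  constructor <;> nlinarith

theorem wc_isWall (P A : Set (EucV ℓ)) (hP : P.Finite) (hA : IsAlcove Set.univ P A)
    (r : EucV ℓ → ℤ) (hr : IsAddress P A r) (α y : EucV ℓ)
    (hαy : ⟪α, y⟫_ℝ = r α)
    (hy : ∀ γ ∈ P, (r γ : ℝ) - 1 < ⟪γ, y⟫_ℝ ∧ (γ ≠ α → ⟪γ, y⟫_ℝ < r γ)) :
    IsWall Set.univ α (r α) A := by
  intro z _ hz
  have hyle : ∀ γ ∈ P, (r γ : ℝ) - 1 < ⟪γ, y⟫_ℝ ∧ ⟪γ, y⟫_ℝ ≤ r γ := by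
    intro γ hγ
    refine ⟨(hy γ hγ).1, ?_⟩
    by_cases h : γ = α
    · rw [h, hαy]
    · exact ((hy γ hγ).2 h).le
  obtain ⟨η, hη, hηP⟩ := wc_segment_eventually P hP r α y (z - y) hyle
    (fun γ hγ hne heq => absurd heq ((hy γ hγ).2 hne).ne)
  have hα' : ⟪α, y + η • (z - y)⟫_ℝ = r α := by
    rw [inner_add_right, real_inner_smul_right, inner_sub_right, hz, hαy]; ring
  have m1 : y ∈ ({x ∈ Set.univ | ⟪α, x⟫_ℝ = (r α : ℝ)} ∩ closure A : Set (EucV ℓ)) :=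
    ⟨⟨trivial, hαy⟩, wc_mem_closure P A hA r hr y
      (fun γ hγ => ⟨(hyle γ hγ).1.le, (hyle γ hγ).2⟩)⟩
  have m2 : y + η • (z - y) ∈
      ({x ∈ Set.univ | ⟪α, x⟫_ℝ = (r α : ℝ)} ∩ closure A : Set (EucV ℓ)) := by
    refine ⟨⟨trivial, hα'⟩, wc_mem_closure P A hA r hr _ (fun γ hγ => ⟨(hηP γ hγ).1.le, ?_⟩)⟩
    by_cases h : γ = α
    · rw [h, hα']
    · exact ((hηP γ hγ).2 h).le
  have := AffineMap.lineMap_mem (k := ℝ) η⁻¹ (subset_affineSpan ℝ _ m1) (subset_affineSpan ℝ _ m2)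
  convert this using 1
  rw [AffineMap.lineMap_apply, vsub_eq_sub, vadd_eq_add, add_sub_cancel_left, smul_smul,
    inv_mul_cancel₀ hη.ne', one_smul, sub_add_cancel]

theorem wc_upper_mid (P A : Set (EucV ℓ)) (hA : IsAlcove Set.univ P A)
    (r : EucV ℓ → ℤ) (hr : IsAddress P A r) (x y : EucV ℓ)
    (hx : x ∈ upperClos P A r) (hy : y ∈ upperClos P A r) :
    (1/2 : ℝ) • (x + y) ∈ upperClos P A r := by
  have e : ∀ γ : EucV ℓ, ⟪γ, (1/2 : ℝ) • (x + y)⟫_ℝ = (⟪γ, x⟫_ℝ + ⟪γ, y⟫_ℝ) / 2 := by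
    intro γ
    rw [real_inner_smul_right, inner_add_right]; ring
  refine ⟨wc_mem_closure P A hA r hr _ (fun γ hγ => ?_), fun γ hγ => ?_⟩
  · have h1 := wc_closure_le P A r hr x hx.1 γ hγ
    have h2 := wc_closure_le P A r hr y hy.1 γ hγ
    rw [e]
    constructor <;> linarith
  · have h1 := hx.2 γ hγ
    have h2 := hy.2 γ hγ
    rw [e]
    linarith

theorem wc_neg_main (rs : RootSystemData ℓ) (S : Set (EucV ℓ)) (hS : S ⊆ rs.Pos)
    (hco : NegCoclosed rs.Pos S) : WCompat Set.univ rs.Pos rs.Δ S := by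
  intro A hA hAP r hr α hαS n
  rw [or_iff_not_imp_left]
  intro hF
  set F := upperClos rs.Pos A r ∩ {x : EucV ℓ | ⟪α, x⟫_ℝ = (n : ℝ)} with hFdef
  have hFne : F.Nonempty := Set.nonempty_iff_ne_empty.2 hF
  have hPf := wc_pos_finite rs
  obtain ⟨x₀, hx₀⟩ : A.Nonempty := by
    obtain ⟨x₀, hx₀, rfl⟩ := hA
    exact ⟨x₀, mem_connectedComponentIn hx₀⟩
  -- a generic point of `F`
  let T : EucV ℓ → Set (EucV ℓ) := fun x => {β ∈ rs.Pos | ⟪β, x⟫_ℝ = r β}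
  have hTf : ∀ x, (T x).Finite := fun x => hPf.subset (fun _ h => h.1)
  have hmin := WellFounded.has_min (measure (fun x : EucV ℓ => (T x).ncard)).wf F hFne
  obtain ⟨x, hxF, hxmin⟩ := hmin
  have hTF : ∀ y ∈ F, T x ⊆ T y := by
    intro y hy
    set z := (1/2 : ℝ) • (x + y) with hz
    have e : ∀ γ : EucV ℓ, ⟪γ, z⟫_ℝ = (⟪γ, x⟫_ℝ + ⟪γ, y⟫_ℝ) / 2 := by
      intro γ
      rw [hz, real_inner_smul_right, inner_add_right]; ring
    have hzF : z ∈ F := by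
      refine ⟨wc_upper_mid _ A hA r hr x y hxF.1 hy.1, ?_⟩
      have h1 : ⟪α, x⟫_ℝ = n := hxF.2
      have h2 : ⟪α, y⟫_ℝ = n := hy.2
      show ⟪α, z⟫_ℝ = n
      rw [e, h1, h2]; ring
    have hsub : T z ⊆ T x ∩ T y := by
      rintro γ ⟨hγ, hγz⟩
      have h1 := (wc_closure_le _ A r hr x hxF.1.1 γ hγ).2
      have h2 := (wc_closure_le _ A r hr y hy.1.1 γ hγ).2
      rw [e] at hγz
      exact ⟨⟨hγ, by linarith⟩, ⟨hγ, by linarith⟩⟩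
    have hle : (T x).ncard ≤ (T z).ncard := by
      exact not_lt.1 (hxmin z hzF)
    have heq := Set.eq_of_subset_of_ncard_le (hsub.trans Set.inter_subset_left) hle (hTf x)
    rw [← heq]
    exact hsub.trans Set.inter_subset_right
  -- properties of `x`
  have hxP : ∀ γ ∈ rs.Pos, (r γ : ℝ) - 1 < ⟪γ, x⟫_ℝ ∧ ⟪γ, x⟫_ℝ ≤ r γ := fun γ hγ =>
    ⟨hxF.1.2 γ hγ, (wc_closure_le _ A r hr x hxF.1.1 γ hγ).2⟩
  have hint : ∀ γ ∈ rs.Pos, ∀ k : ℤ, ⟪γ, x⟫_ℝ = k → ⟪γ, x⟫_ℝ = r γ := by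
    intro γ hγ k hk
    have := hxP γ hγ
    rw [hk] at this ⊢
    have h1 : r γ - 1 < k := by exact_mod_cast this.1
    have h2 : k ≤ r γ := by exact_mod_cast this.2
    exact_mod_cast (by omega : k = r γ)
  set v := x - x₀ with hv
  have hvpos : ∀ γ ∈ rs.Pos, ⟪γ, x⟫_ℝ = r γ → 0 < ⟪γ, v⟫_ℝ := by
    intro γ hγ h
    rw [hv, inner_sub_right, h]
    have := (hr γ hγ x₀ hx₀).2
    linarith
  -- minimal element of `S` through `x`
  set M := {β ∈ S | ⟪β, x⟫_ℝ = r β} with hM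
  obtain ⟨β, ⟨hβS, hβx⟩, hβmin⟩ := Set.exists_min_image M (fun c => ⟪c, v⟫_ℝ)
    (hPf.subset (fun c hc => hS hc.1)) ⟨α, hαS, hint α (hS hαS) n hxF.2⟩
  have hβP := hS hβS
  refine ⟨β, hβS, r β, rfl, ?_, ?_, fun y hy => (hTF y hy ⟨hβP, hβx⟩).2⟩
  · have h1 := (hr β hβP x₀ hx₀).2
    have h2 : 0 ≤ ⟪β, x₀⟫_ℝ := by
      obtain ⟨s, c, hs, hc⟩ := hβP.2
      rw [hc, sum_inner]
      refine Finset.sum_nonneg (fun b hb => ?_)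
      rw [real_inner_smul_left]
      exact mul_nonneg (Nat.cast_nonneg _) ((hAP hx₀).2 b (hs hb)).1.le
    have : (0:ℝ) < r β := lt_of_le_of_lt h2 h1
    exact_mod_cast this
  -- the local root system
  set Ψ : Set (EucV ℓ) := {γ ∈ rs.Φ | ∃ k : ℤ, ⟪γ, x⟫_ℝ = k} with hΨ
  have hΨneg : ∀ b ∈ Ψ, -b ∈ Ψ := by
    rintro b ⟨hb, k, hk⟩
    exact ⟨rs.neg_mem b hb, -k, by rw [inner_neg_left, hk]; push_cast; ring⟩
  have hΨpos : ∀ b ∈ Ψ, b ∈ rs.Pos ∧ 0 < ⟪b, v⟫_ℝ ∨ ⟪b, v⟫_ℝ < 0 := by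
    rintro b ⟨hb, k, hk⟩
    rcases rs.pos_or_neg b hb with h | h
    · exact Or.inl ⟨⟨hb, h⟩, hvpos b ⟨hb, h⟩ (hint b ⟨hb, h⟩ k hk)⟩
    · right
      have hb' : -b ∈ rs.Pos := ⟨rs.neg_mem b hb, h⟩
      have := hvpos _ hb' (hint _ hb' (-k) (by rw [inner_neg_left, hk]; push_cast; ring))
      rw [inner_neg_left] at this
      linarith
  have hΨpos' : ∀ b ∈ Ψ, 0 < ⟪b, v⟫_ℝ → b ∈ rs.Pos := by
    intro b hb h
    rcases hΨpos b hb with h' | h'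
    · exact h'.1
    · linarith
  have hcore := wc_core Ψ (rs.finite.subset (fun _ h => h.1)) hΨneg
    (fun a ha t ht => rs.reduced a ha.1 t ht.1)
    (by
      rintro a ⟨ha, k, hk⟩ b ⟨hb, l, hl⟩
      obtain ⟨n, hn⟩ := rs.cryst a ha b hb
      have ha0 : ⟪a, a⟫_ℝ ≠ 0 := by
        rw [inner_self_ne_zero]
        rintro rfl
        exact rs.nonzero ha
      have hre := rs.refl_mem a ha b hb
      rw [hn, mul_div_cancel_right₀ _ ha0] at hre
      refine ⟨n, by rw [real_inner_comm]; exact hn, hre, l - n * k, ?_⟩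
      rw [inner_sub_left, real_inner_smul_left, hk, hl]
      push_cast; ring)
    v (fun b hb => by rcases hΨpos b hb with h | h <;> [exact h.2.ne'; exact h.ne])
    β ⟨hβP.1, r β, hβx⟩ (hvpos β hβP hβx)
    (by
      intro p hp q hq hpv hqv d₁ d₂ hd₁ hd₂ heq hpq
      have hpP := hΨpos' p hp hpv
      have hqP := hΨpos' q hq hqv
      have hval : ⟪β, v⟫_ℝ = d₁ * ⟪p, v⟫_ℝ + d₂ * ⟪q, v⟫_ℝ := by
        rw [heq, inner_add_left, real_inner_smul_left, real_inner_smul_left]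
      have h1 : (1:ℝ) ≤ d₁ := by exact_mod_cast hd₁
      have h2 : (1:ℝ) ≤ d₂ := by exact_mod_cast hd₂
      rcases hco β hβS p hpP q hqP d₁ d₂ hd₁ hd₂ heq hpq with h | h
      · obtain ⟨-, k, hk⟩ := hp
        have := hβmin p ⟨h, hint p hpP k hk⟩
        nlinarith
      · obtain ⟨-, k, hk⟩ := hq
        have := hβmin q ⟨h, hint q hqP k hk⟩
        nlinarith)
  have hββ : 0 < ⟪β, β⟫_ℝ := by
    rw [real_inner_self_pos]
    rintro rfl
    exact rs.nonzero hβP.1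
  obtain ⟨ε, hε, hεP⟩ := wc_segment_eventually rs.Pos hPf r β x
    ((⟪β, v⟫_ℝ / ⟪β, β⟫_ℝ) • β - v) hxP (by
      intro γ hγ hne heq
      have := hcore γ ⟨hγ.1, r γ, heq⟩ (hvpos γ hγ heq) hne
      rw [inner_sub_right, real_inner_smul_right, real_inner_comm β γ, sub_neg, div_mul_eq_mul_div,
        div_lt_iff₀ hββ]
      exact this)
  refine wc_isWall rs.Pos A hPf hA r hr β _ ?_ hεP
  rw [inner_add_right, real_inner_smul_right, inner_sub_right, real_inner_smul_right,
    div_mul_cancel₀ _ hββ.ne', hβx]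
  ring

/-- Let `Φ` be an irreducible crystallographic root system. Every negatively
coclosed subset of `Φ⁺` is Worpitzky-compatible; in particular every coclosed
subset is Worpitzky-compatible. -/
theorem negatively_coclosed_implies_worpitzky_compatible
    {ℓ : ℕ} (rs : RootSystemData ℓ) (hirr : IrredSet rs.Φ)
    (S : Set (EucV ℓ)) (hS : S ⊆ rs.Pos) :
    (NegCoclosed rs.Pos S → WCompat Set.univ rs.Pos rs.Δ S) ∧
    (Coclosed rs.Pos S → WCompat Set.univ rs.Pos rs.Δ S) := by
  have _ := hirr
  exact ⟨wc_neg_main rs S hS, fun hc => wc_neg_main rs S hS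
    (fun α hα p hp q hq d₁ d₂ h₁ h₂ he _ => hc α hα p hp q hq d₁ d₂ h₁ h₂ he)⟩

end
end

section
/- Let G be a simple graph on vertex set [ℓ] = {1,…,ℓ} with edge set E_G, and let Σ(G) := {εᵢ − εⱼ : {i,j} ∈ E_G, i < j} ⊆ Φ⁺(A_{ℓ−1}). Then Σ(G) is negatively coclosed in Φ⁺(A_{ℓ−1}) if and only if for all 1 ≤ i < k < j ≤ ℓ with {i,j} ∈ E_G, either {i,k} ∈ E_G or {k,j} ∈ E_G. -/
open scoped InnerProductSpace

noncomputable section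

variable {ℓ : ℕ}

theorem aux_single_apply (i j k : Fin ℓ) :
    (EuclideanSpace.single i (1:ℝ) - EuclideanSpace.single j (1:ℝ) : EucV ℓ) k
      = (if k = i then 1 else 0) - (if k = j then 1 else 0) := by
  simp [Pi.single_apply]

theorem aux_inj {i j a b : Fin ℓ} (hij : i < j)
    (h : (EuclideanSpace.single i (1:ℝ) - EuclideanSpace.single j (1:ℝ) : EucV ℓ)
      = EuclideanSpace.single a (1:ℝ) - EuclideanSpace.single b (1:ℝ)) : i = a ∧ j = b := by
  have h1 := congrArg (fun v : EucV ℓ => v i) h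
  have h2 := congrArg (fun v : EucV ℓ => v j) h
  simp only [aux_single_apply] at h1 h2
  have n1 : i ≠ j := hij.ne
  have n2 : j ≠ i := hij.ne'
  constructor
  · by_contra hne
    simp only [n1, hne, if_true, if_false] at h1
    split_ifs at h1 <;> norm_num at h1
  · by_contra hne
    simp only [n2, hne, if_true, if_false] at h2
    split_ifs at h2 <;> norm_num at h2

theorem aux_sum {i j a b d : Fin ℓ} (hab : a < b) (hbd : b < d) {m n : ℤ}
    (hm : 0 < m) (hn : 0 < n)
    (h : (EuclideanSpace.single i (1:ℝ) - EuclideanSpace.single j (1:ℝ) : EucV ℓ)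
      = (m:ℝ) • (EuclideanSpace.single a (1:ℝ) - EuclideanSpace.single b (1:ℝ) : EucV ℓ)
      + (n:ℝ) • (EuclideanSpace.single b (1:ℝ) - EuclideanSpace.single d (1:ℝ) : EucV ℓ)) :
    i = a ∧ j = d := by
  have hm' : (0:ℝ) < m := by exact_mod_cast hm
  have hn' : (0:ℝ) < n := by exact_mod_cast hn
  have h1 := congrArg (fun v : EucV ℓ => v a) h
  have h2 := congrArg (fun v : EucV ℓ => v d) h
  simp only [PiLp.add_apply, PiLp.smul_apply, aux_single_apply, smul_eq_mul] at h1 h2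
  have had := hab.trans hbd
  simp only [hab.ne, had.ne, if_true, if_false] at h1
  simp only [hbd.ne', had.ne', if_true, if_false] at h2
  constructor
  · by_contra hne
    simp only [Ne.symm hne, if_false] at h1
    split_ifs at h1 <;> linarith
  · by_contra hne
    simp only [Ne.symm hne, if_false] at h2
    split_ifs at h2 <;> linarith

theorem aux_inner {a b c d : Fin ℓ}
    (h : ⟪(EuclideanSpace.single a (1:ℝ) - EuclideanSpace.single b (1:ℝ) : EucV ℓ),
      (EuclideanSpace.single c (1:ℝ) - EuclideanSpace.single d (1:ℝ) : EucV ℓ)⟫_ℝ < 0) :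
    b = c ∨ a = d := by
  by_contra! hne
  rw [inner_sub_left, EuclideanSpace.inner_single_left, EuclideanSpace.inner_single_left,
    aux_single_apply, aux_single_apply] at h
  simp only [hne.1, hne.2, if_false, map_one, one_mul] at h
  split_ifs at h <;> linarith

/-- **Graphic characterization in type A.** For a simple graph `G` on `[ℓ]`, the set
`Σ(G) = {εᵢ - εⱼ : {i,j} ∈ E_G, i < j} ⊆ Φ⁺(A_{ℓ-1})` is negatively coclosed iff
for all `i < k < j` with `{i,j} ∈ E_G`, either `{i,k} ∈ E_G` or `{k,j} ∈ E_G`. -/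
theorem graph_negatively_coclosed_iff
    {ℓ : ℕ} (G : SimpleGraph (Fin ℓ)) :
    NegCoclosed
      {v : EucV ℓ | ∃ i j : Fin ℓ, i < j ∧
        v = EuclideanSpace.single i (1:ℝ) - EuclideanSpace.single j (1:ℝ)}
      {v : EucV ℓ | ∃ i j : Fin ℓ, i < j ∧ G.Adj i j ∧
        v = EuclideanSpace.single i (1:ℝ) - EuclideanSpace.single j (1:ℝ)} ↔
    (∀ i k j : Fin ℓ, i < k → k < j → G.Adj i j → G.Adj i k ∨ G.Adj k j) := by
  constructor
  · intro H i k j hik hkj hadj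
    have := H _ ⟨i, j, hik.trans hkj, hadj, rfl⟩ _ ⟨i, k, hik, rfl⟩ _ ⟨k, j, hkj, rfl⟩ 1 1
      one_pos one_pos (by simp) (by
        rw [inner_sub_left, EuclideanSpace.inner_single_left, EuclideanSpace.inner_single_left,
          aux_single_apply, aux_single_apply]
        simp [hik.ne, hkj.ne, (hik.trans hkj).ne])
    rcases this with ⟨a, b, hab, hG, he⟩ | ⟨a, b, hab, hG, he⟩
    · obtain ⟨rfl, rfl⟩ := aux_inj hik he
      exact Or.inl hG
    · obtain ⟨rfl, rfl⟩ := aux_inj hkj he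
      exact Or.inr hG
  · rintro H _ ⟨i, j, hij, hadj, rfl⟩ _ ⟨a, b, hab, rfl⟩ _ ⟨c, d, hcd, rfl⟩ m n hm hn he hin
    rcases aux_inner hin with rfl | rfl
    · obtain ⟨rfl, rfl⟩ := aux_sum hab hcd hm hn he
      rcases H _ _ _ hab hcd hadj with h | h
      · exact Or.inl ⟨_, _, hab, h, rfl⟩
      · exact Or.inr ⟨_, _, hcd, h, rfl⟩
    · rw [add_comm] at he
      obtain ⟨rfl, rfl⟩ := aux_sum hcd hab hn hm he
      rcases H _ _ _ hcd hab hadj with h | h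
      · exact Or.inr ⟨_, _, hcd, h, rfl⟩
      · exact Or.inl ⟨_, _, hab, h, rfl⟩

end
end

section
/- Let Φ be an irreducible crystallographic root system and let β₁, β₂, β₃ ∈ Φ satisfy β₁ + β₂ + β₃ ∈ Φ and βᵢ + βⱼ ≠ 0 for all i ≠ j. Then at least two of the three partial sums β₁+β₂, β₁+β₃, β₂+β₃ belong to Φ. -/
open scoped InnerProductSpace

noncomputable section

variable {ℓ : ℕ}

theorem aux_add_mem {ℓ : ℕ} (rs : RootSystemData ℓ) (a b : EucV ℓ) (ha : a ∈ rs.Φ)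
    (hb : b ∈ rs.Φ) (hne : a + b ≠ 0) (hab : a + b ∉ rs.Φ) : 0 ≤ ⟪a, b⟫_ℝ := by
  by_contra hlt
  push Not at hlt
  have key : ∀ x y : EucV ℓ, x ∈ rs.Φ → y ∈ rs.Φ → x + y ∉ rs.Φ → ⟪x, y⟫_ℝ < 0 →
      ⟪x, y⟫_ℝ ≤ - ⟪x, x⟫_ℝ := by
    intro x y hx hy hxy hn
    obtain ⟨n, hn'⟩ := rs.cryst x hx y hy
    have hr := rs.refl_mem x hx y hy
    have hx0 : x ≠ 0 := fun h => rs.nonzero (h ▸ hx)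
    have hp : 0 < ⟪x, x⟫_ℝ := real_inner_self_pos.mpr hx0
    rw [hn', mul_div_cancel_right₀ _ hp.ne'] at hr
    rw [real_inner_comm] at hn'
    have hn0 : n < 0 := by
      by_contra h
      have : (0:ℝ) ≤ n := by exact_mod_cast not_lt.mp h
      nlinarith
    have hn1 : n ≠ -1 := by
      rintro rfl
      apply hxy
      have e : y - ((-1 : ℤ) : ℝ) • x = x + y := by
        push_cast
        module
      rwa [e] at hr
    have : (n:ℝ) ≤ -2 := by exact_mod_cast (by omega : n ≤ -2)
    nlinarith
  have k1 := key a b ha hb hab hlt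
  have k2 := key b a hb ha (by rwa [add_comm]) (by rwa [real_inner_comm])
  rw [real_inner_comm] at k2
  have : ⟪a + b, a + b⟫_ℝ ≤ 0 := by
    rw [real_inner_add_add_self]
    linarith
  exact hne (real_inner_self_nonpos.mp this)

theorem aux_two {ℓ : ℕ} (rs : RootSystemData ℓ)
    (a b c : EucV ℓ) (ha : a ∈ rs.Φ) (hb : b ∈ rs.Φ) (hc : c ∈ rs.Φ)
    (hsum : a + b + c ∈ rs.Φ)
    (hab : a + b ≠ 0) (hac : a + c ≠ 0) (hbc : b + c ≠ 0)
    (nab : a + b ∉ rs.Φ) (nac : a + c ∉ rs.Φ) : False := by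
  have hd := rs.neg_mem _ hsum
  have e1 : c + -(a + b + c) = -(a + b) := by abel
  have e2 : b + -(a + b + c) = -(a + c) := by abel
  have i1 := aux_add_mem rs a b ha hb hab nab
  have i2 := aux_add_mem rs a c ha hc hac nac
  have i3 := aux_add_mem rs c _ hc hd (by rw [e1]; exact neg_ne_zero.mpr hab)
    (by rw [e1]; intro h; exact nab (by simpa using rs.neg_mem _ h))
  have i4 := aux_add_mem rs b _ hb hd (by rw [e2]; exact neg_ne_zero.mpr hac)
    (by rw [e2]; intro h; exact nac (by simpa using rs.neg_mem _ h))
  have : ⟪b + c, b + c⟫_ℝ ≤ 0 := by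
    simp only [inner_add_left, inner_add_right, inner_neg_right] at *
    have := real_inner_comm a b
    have := real_inner_comm a c
    have := real_inner_comm b c
    linarith
  exact hbc (real_inner_self_nonpos.mp this)

/-- **Lemma 3.3.** Let `Φ` be an irreducible crystallographic root system and
`β₁, β₂, β₃ ∈ Φ` with `β₁ + β₂ + β₃ ∈ Φ` and `βᵢ + βⱼ ≠ 0` for `i ≠ j`. Then at
least two of the three partial sums `βᵢ + βⱼ` belong to `Φ`. -/
theorem three_roots_partial_sums
    {ℓ : ℕ} (rs : RootSystemData ℓ) (hirr : IrredSet rs.Φ)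
    (β₁ β₂ β₃ : EucV ℓ) (h1 : β₁ ∈ rs.Φ) (h2 : β₂ ∈ rs.Φ) (h3 : β₃ ∈ rs.Φ)
    (hsum : β₁ + β₂ + β₃ ∈ rs.Φ)
    (h12 : β₁ + β₂ ≠ 0) (h13 : β₁ + β₃ ≠ 0) (h23 : β₂ + β₃ ≠ 0) :
    (β₁ + β₂ ∈ rs.Φ ∧ β₁ + β₃ ∈ rs.Φ) ∨
    (β₁ + β₂ ∈ rs.Φ ∧ β₂ + β₃ ∈ rs.Φ) ∨
    (β₁ + β₃ ∈ rs.Φ ∧ β₂ + β₃ ∈ rs.Φ) := by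
  by_cases p12 : β₁ + β₂ ∈ rs.Φ
  · by_cases p13 : β₁ + β₃ ∈ rs.Φ
    · exact Or.inl ⟨p12, p13⟩
    · by_cases p23 : β₂ + β₃ ∈ rs.Φ
      · exact Or.inr (Or.inl ⟨p12, p23⟩)
      · exact (aux_two rs β₃ β₁ β₂ h3 h1 h2 (by convert hsum using 1; abel)
          (by rwa [add_comm]) (by rwa [add_comm]) h12
          (by rwa [add_comm]) (by rwa [add_comm])).elim
  · by_cases p13 : β₁ + β₃ ∈ rs.Φ
    · by_cases p23 : β₂ + β₃ ∈ rs.Φ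
      · exact Or.inr (Or.inr ⟨p13, p23⟩)
      · exact (aux_two rs β₂ β₁ β₃ h2 h1 h3 (by convert hsum using 1; abel)
          (by rwa [add_comm]) h23 h13 (by rwa [add_comm]) p23).elim
    · exact (aux_two rs β₁ β₂ β₃ h1 h2 h3 hsum h12 h13 h23 p12 p13).elim

end
end
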